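/- arXiv:1307.2686 — 2 statements merged into one kernel-verified Lean document; each statement's English description precedes it below -/
import Mathlib

section
/- Fix α ∈ (0,1), let ρ(ξ) = min(1, ξ^{1+α}) and H = L²((0,∞), ρ(ξ)dξ). Let G(t,ξ,η) = (4πt)^{-1/2}( e^{-(ξ−η)²/(4t)} − e^{-(ξ+η)²/(4t)} ) for t > 0 and ξ,η ≥ 0, and define T_t f(ξ) = ∫₀^∞ G(t,ξ,η) f(η) dη for f ∈ H, with T_0 = I. Then each T_t is a bounded linear operator on H, T_{t+s} = T_t T_s for all s,t ≥ 0, and ‖T_t f − f‖_H → 0 as t ↓ 0 for every f ∈ H; i.e. (T_t)_{t≥0} is a strongly continuous semigroup on H. -/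
open MeasureTheory Set Filter

section Schur

variable {X : Type*} [MeasurableSpace X] {ν : Measure X}

open scoped ENNReal

theorem sq_lintegral_mul_le_of_weight {k p F : X → ℝ≥0∞} (hk : AEMeasurable k ν)
    (hp : AEMeasurable p ν) (hp0 : ∀ᵐ x ∂ν, p x ≠ 0) (hptop : ∀ᵐ x ∂ν, p x ≠ ∞)
    (hF : AEMeasurable F ν) :
    (∫⁻ x, k x * F x ∂ν) ^ 2 ≤
      (∫⁻ x, k x * p x ∂ν) * ∫⁻ x, k x * (F x ^ 2 / p x) ∂ν := by
  have hsq : ∀ a : ℝ≥0∞, (a ^ (1 / 2 : ℝ)) ^ (2 : ℝ) = a := fun a => by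
    rw [← ENNReal.rpow_mul]; norm_num
  have hsq' : ∀ a : ℝ≥0∞, (a ^ (1 / 2 : ℝ)) ^ 2 = a := fun a => by
    rw [← ENNReal.rpow_natCast, ← ENNReal.rpow_mul]; norm_num
  have holder := ENNReal.lintegral_mul_le_Lp_mul_Lq ν Real.HolderConjugate.two_two
    (f := fun x => (k x * p x) ^ (1 / 2 : ℝ)) (g := fun x => (k x * (F x ^ 2 / p x)) ^ (1 / 2 : ℝ))
    ((hk.mul hp).pow_const _) (by fun_prop)
  simp only [hsq] at holder
  have heq : ∫⁻ x, k x * F x ∂ν = ∫⁻ x, ((fun x => (k x * p x) ^ (1 / 2 : ℝ)) *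
      fun x => (k x * (F x ^ 2 / p x)) ^ (1 / 2 : ℝ)) x ∂ν := by
    refine lintegral_congr_ae ?_
    filter_upwards [hp0, hptop] with x h0 ht
    simp only [Pi.mul_apply]
    rw [← ENNReal.mul_rpow_of_nonneg _ _ (by norm_num)]
    have : k x * p x * (k x * (F x ^ 2 / p x)) = (k x * F x) ^ (2 : ℝ) := by
      rw [ENNReal.rpow_two]
      calc k x * p x * (k x * (F x ^ 2 / p x))
          = k x * k x * F x ^ 2 * (p x * (p x)⁻¹) := by rw [div_eq_mul_inv]; ring
        _ = _ := by rw [ENNReal.mul_inv_cancel h0 ht]; ring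
    rw [this, ← ENNReal.rpow_mul]; norm_num
  rw [heq]
  calc _ ≤ _ := pow_le_pow_left' holder 2
    _ = _ := by rw [mul_pow, hsq', hsq']

/-- The Schur test for a nonnegative kernel on a weighted `L²` space. -/
theorem lintegral_sq_lintegral_mul_le [SFinite ν] {k : X → X → ℝ≥0∞} {p w F : X → ℝ≥0∞}
    {C₁ C₂ : ℝ≥0∞}
    (hk : Measurable (Function.uncurry k)) (hp : Measurable p) (hw : Measurable w)
    (hp0 : ∀ᵐ x ∂ν, p x ≠ 0) (hptop : ∀ᵐ x ∂ν, p x ≠ ∞) (hF : AEMeasurable F ν)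
    (hrow : ∀ᵐ x ∂ν, ∫⁻ y, k x y * p y ∂ν ≤ C₁ * p x)
    (hcol : ∀ᵐ y ∂ν, ∫⁻ x, k x y * (w x * p x) ∂ν ≤ C₂ * (w y * p y)) :
    ∫⁻ x, w x * (∫⁻ y, k x y * F y ∂ν) ^ 2 ∂ν ≤ C₁ * C₂ * ∫⁻ x, w x * F x ^ 2 ∂ν := by
  have hq : AEMeasurable (fun y => F y ^ 2 / p y) ν := (hF.pow_const 2).div hp.aemeasurable
  have hjoint : AEMeasurable
      (Function.uncurry fun x y => w x * (C₁ * p x * (k x y * (F y ^ 2 / p y)))) (ν.prod ν) := by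
    refine (hw.comp measurable_fst).aemeasurable.mul
      (((hp.comp measurable_fst).const_mul C₁).aemeasurable.mul
        (hk.aemeasurable.mul ?_))
    exact hq.comp_quasiMeasurePreserving Measure.quasiMeasurePreserving_snd
  calc ∫⁻ x, w x * (∫⁻ y, k x y * F y ∂ν) ^ 2 ∂ν
      ≤ ∫⁻ x, ∫⁻ y, w x * (C₁ * p x * (k x y * (F y ^ 2 / p y))) ∂ν ∂ν := by
        refine lintegral_mono_ae ?_
        filter_upwards [hrow] with x hx
        have hkx : Measurable (k x) := hk.comp measurable_prodMk_left
        have hkq : AEMeasurable (fun y => k x y * (F y ^ 2 / p y)) ν := hkx.aemeasurable.mul hq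
        rw [lintegral_const_mul'' _ (hkq.const_mul _), lintegral_const_mul'' _ hkq]
        gcongr
        exact (sq_lintegral_mul_le_of_weight hkx.aemeasurable hp.aemeasurable hp0 hptop hF).trans
          (by gcongr)
    _ = ∫⁻ y, ∫⁻ x, w x * (C₁ * p x * (k x y * (F y ^ 2 / p y))) ∂ν ∂ν :=
        lintegral_lintegral_swap hjoint
    _ ≤ ∫⁻ y, C₁ * C₂ * (w y * F y ^ 2) ∂ν := by
        refine lintegral_mono_ae ?_
        filter_upwards [hcol, hp0, hptop] with y hy h0 ht
        have hky : Measurable fun x => k x y := hk.comp measurable_prodMk_right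
        calc ∫⁻ x, w x * (C₁ * p x * (k x y * (F y ^ 2 / p y))) ∂ν
            = ∫⁻ x, C₁ * (F y ^ 2 / p y) * (k x y * (w x * p x)) ∂ν := by
              refine lintegral_congr fun x => by ring
          _ = C₁ * (F y ^ 2 / p y) * ∫⁻ x, k x y * (w x * p x) ∂ν :=
              lintegral_const_mul _ (hky.mul (hw.mul hp))
          _ ≤ C₁ * (F y ^ 2 / p y) * (C₂ * (w y * p y)) := by gcongr
          _ = C₁ * C₂ * (w y * F y ^ 2) * (p y * (p y)⁻¹) := by rw [div_eq_mul_inv]; ring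
          _ = _ := by rw [ENNReal.mul_inv_cancel h0 ht, mul_one]
    _ = _ := lintegral_const_mul'' _ (hw.aemeasurable.mul (hF.pow_const 2))

theorem eLpNorm_two_sq {f : X → ℝ} : eLpNorm f 2 ν ^ 2 = ∫⁻ x, ‖f x‖ₑ ^ 2 ∂ν := by
  have := eLpNorm_nnreal_pow_eq_lintegral (μ := ν) (f := f) (p := 2) two_ne_zero
  simpa using this

theorem eLpNorm_two_withDensity_sq {w : X → ℝ≥0∞} {f : X → ℝ} (hw : Measurable w)
    (hf : AEStronglyMeasurable f ν) :
    eLpNorm f 2 (ν.withDensity w) ^ 2 = ∫⁻ x, w x * ‖f x‖ₑ ^ 2 ∂ν := by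
  rw [eLpNorm_two_sq, lintegral_withDensity_eq_lintegral_mul₀ hw.aemeasurable
    (hf.enorm.pow_const 2)]
  rfl

/-- The Schur bound with constant `C` for the kernel `k` on `L²(w ν)`. -/
def SchurBound (ν : Measure X) (w : X → ℝ≥0∞) (k : X → X → ℝ) (C : ℝ≥0∞) : Prop :=
  ∀ F : X → ℝ≥0∞, AEMeasurable F ν →
    ∫⁻ x, w x * (∫⁻ y, ‖k x y‖ₑ * F y ∂ν) ^ 2 ∂ν ≤ C * ∫⁻ x, w x * F x ^ 2 ∂ν

variable {w : X → ℝ≥0∞} {k : X → X → ℝ} {C : ℝ≥0∞}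

namespace SchurBound

theorem ae_lintegral_lt_top [SFinite ν] (h : SchurBound ν w k C) (hC : C ≠ ∞)
    (hk : Measurable (Function.uncurry k)) (hw : Measurable w) (hw0 : ∀ᵐ x ∂ν, w x ≠ 0)
    {F : X → ℝ≥0∞} (hF : AEMeasurable F ν) (hfin : ∫⁻ x, w x * F x ^ 2 ∂ν ≠ ∞) :
    ∀ᵐ x ∂ν, ∫⁻ y, ‖k x y‖ₑ * F y ∂ν < ∞ := by
  have hmeas : AEMeasurable (fun x => ∫⁻ y, ‖k x y‖ₑ * F y ∂ν) ν := by
    refine AEMeasurable.lintegral_prod_right' (f := fun z : X × X => ‖k z.1 z.2‖ₑ * F z.2) ?_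
    exact hk.enorm.aemeasurable.mul
      (hF.comp_quasiMeasurePreserving Measure.quasiMeasurePreserving_snd)
  have := ae_lt_top' (hw.aemeasurable.mul (hmeas.pow_const 2))
    (ne_top_of_le_ne_top (ENNReal.mul_ne_top hC hfin) (h F hF))
  filter_upwards [this, hw0] with x hx h0
  by_contra hcon
  simp only [not_lt, top_le_iff] at hcon
  simp [hcon, h0] at hx

theorem ae_integrable [SFinite ν] (h : SchurBound ν w k C) (hC : C ≠ ∞)
    (hk : Measurable (Function.uncurry k)) (hw : Measurable w) (hw0 : ∀ᵐ x ∂ν, w x ≠ 0)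
    {f : X → ℝ} (hf : MemLp f 2 (ν.withDensity w)) :
    ∀ᵐ x ∂ν, Integrable (fun y => k x y * f y) ν := by
  have hfν : AEStronglyMeasurable f ν :=
    hf.1.mono_ac (withDensity_absolutelyContinuous' hw.aemeasurable hw0)
  have hfin : ∫⁻ x, w x * ‖f x‖ₑ ^ 2 ∂ν ≠ ∞ := by
    rw [← eLpNorm_two_withDensity_sq hw hfν]
    exact ENNReal.pow_ne_top hf.eLpNorm_ne_top
  filter_upwards [h.ae_lintegral_lt_top hC hk hw hw0 hfν.enorm hfin] with x hx
  refine ⟨(hk.comp measurable_prodMk_left).aestronglyMeasurable.mul hfν, ?_⟩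
  simpa [HasFiniteIntegral, enorm_mul] using hx

theorem eLpNorm_le [SFinite ν] (h : SchurBound ν w k C)
    (hk : Measurable (Function.uncurry k)) (hw : Measurable w) (hw0 : ∀ᵐ x ∂ν, w x ≠ 0)
    {f : X → ℝ} (hf : MemLp f 2 (ν.withDensity w)) :
    AEStronglyMeasurable (fun x => ∫ y, k x y * f y ∂ν) ν ∧
    eLpNorm (fun x => ∫ y, k x y * f y ∂ν) 2 (ν.withDensity w) ≤
      C ^ (1 / 2 : ℝ) * eLpNorm f 2 (ν.withDensity w) := by
  have hfν : AEStronglyMeasurable f ν :=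
    hf.1.mono_ac (withDensity_absolutelyContinuous' hw.aemeasurable hw0)
  have hmeas : AEStronglyMeasurable (fun x => ∫ y, k x y * f y ∂ν) ν := by
    refine AEStronglyMeasurable.integral_prod_right' (f := fun z : X × X => k z.1 z.2 * f z.2) ?_
    exact hk.aestronglyMeasurable.mul
      (hfν.comp_quasiMeasurePreserving Measure.quasiMeasurePreserving_snd)
  refine ⟨hmeas, ?_⟩
  rw [← ENNReal.pow_le_pow_left_iff two_ne_zero, mul_pow,
    eLpNorm_two_withDensity_sq hw hmeas, eLpNorm_two_withDensity_sq hw hfν,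
    ← ENNReal.rpow_natCast, ← ENNReal.rpow_mul]
  norm_num
  refine le_trans (lintegral_mono fun x => ?_) (h _ hfν.enorm)
  gcongr
  refine (enorm_integral_le_lintegral_enorm _).trans_eq ?_
  simp [enorm_mul]

/-- A kernel with a finite Schur bound defines a bounded operator on the weighted `L²` space. -/
theorem exists_continuousLinearMap [SFinite ν] (h : SchurBound ν w k C) (hC : C ≠ ∞)
    (hk : Measurable (Function.uncurry k)) (hw : Measurable w) (hw0 : ∀ᵐ x ∂ν, w x ≠ 0) :
    ∃ T : Lp ℝ 2 (ν.withDensity w) →L[ℝ] Lp ℝ 2 (ν.withDensity w),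
      (∀ f, T f =ᵐ[ν.withDensity w] fun x => ∫ y, k x y * f y ∂ν) ∧
      ∀ f, ‖T f‖ ≤ (C ^ (1 / 2 : ℝ)).toReal * ‖f‖ := by
  have hac := withDensity_absolutelyContinuous ν w
  have hac' := withDensity_absolutelyContinuous' hw.aemeasurable hw0
  have hCtop : C ^ (1 / 2 : ℝ) ≠ ∞ := ENNReal.rpow_ne_top_of_nonneg (by norm_num) hC
  have hmem : ∀ f : Lp ℝ 2 (ν.withDensity w),
      MemLp (fun x => ∫ y, k x y * f y ∂ν) 2 (ν.withDensity w) := fun f => by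
    obtain ⟨h1, h2⟩ := h.eLpNorm_le hk hw hw0 (Lp.memLp f)
    exact ⟨h1.mono_ac hac,
      h2.trans_lt (ENNReal.mul_lt_top hCtop.lt_top (Lp.memLp f).eLpNorm_lt_top)⟩
  let L : Lp ℝ 2 (ν.withDensity w) →ₗ[ℝ] Lp ℝ 2 (ν.withDensity w) :=
    { toFun := fun f => (hmem f).toLp _
      map_add' := fun f g => by
        rw [← MemLp.toLp_add]
        refine MemLp.toLp_congr _ _ (hac.ae_le ?_)
        filter_upwards [h.ae_integrable hC hk hw hw0 (Lp.memLp f),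
          h.ae_integrable hC hk hw hw0 (Lp.memLp g)] with x hf hg
        rw [Pi.add_apply, ← integral_add hf hg]
        refine integral_congr_ae ?_
        filter_upwards [hac'.ae_le (Lp.coeFn_add f g)] with y hy
        rw [hy, Pi.add_apply, mul_add]
      map_smul' := fun c f => by
        rw [RingHom.id_apply, ← MemLp.toLp_const_smul]
        refine MemLp.toLp_congr _ _ (.of_forall fun x => ?_)
        rw [Pi.smul_apply, ← integral_smul]
        refine integral_congr_ae ?_
        filter_upwards [hac'.ae_le (Lp.coeFn_smul c f)] with y hy
        rw [hy, Pi.smul_apply, smul_eq_mul, smul_eq_mul]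
        ring }
  have hbound : ∀ f, ‖L f‖ ≤ (C ^ (1 / 2 : ℝ)).toReal * ‖f‖ := fun f => by
    change ‖(hmem f).toLp _‖ ≤ _
    rw [Lp.norm_toLp, Lp.norm_def, ← ENNReal.toReal_mul]
    exact ENNReal.toReal_mono (ENNReal.mul_ne_top hCtop (Lp.memLp f).eLpNorm_ne_top)
      (h.eLpNorm_le hk hw hw0 (Lp.memLp f)).2
  exact ⟨L.mkContinuous _ hbound, fun f => (hmem f).coeFn_toLp, hbound⟩

/-- If the kernel `l` is the composition of the kernels `j` and `k`, then the integral operators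
compose accordingly. -/
theorem integral_integral_comp [SFinite ν] {j l : X → X → ℝ} {D : ℝ≥0∞}
    (hjb : SchurBound ν w j D) (hkb : SchurBound ν w k C) (hD : D ≠ ∞) (hC : C ≠ ∞)
    (hj : Measurable (Function.uncurry j)) (hk : Measurable (Function.uncurry k))
    (hw : Measurable w) (hw0 : ∀ᵐ x ∂ν, w x ≠ 0)
    (hcomp : ∀ᵐ x ∂ν, ∀ᵐ z ∂ν, ∫ y, j x y * k y z ∂ν = l x z)
    {f : X → ℝ} (hf : MemLp f 2 (ν.withDensity w)) :
    ∀ᵐ x ∂ν, ∫ y, j x y * ∫ z, k y z * f z ∂ν ∂ν = ∫ z, l x z * f z ∂ν := by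
  have hfν : AEStronglyMeasurable f ν :=
    hf.1.mono_ac (withDensity_absolutelyContinuous' hw.aemeasurable hw0)
  have hfin : ∫⁻ x, w x * ‖f x‖ₑ ^ 2 ∂ν ≠ ∞ := by
    rw [← eLpNorm_two_withDensity_sq hw hfν]
    exact ENNReal.pow_ne_top hf.eLpNorm_ne_top
  have hfsnd : AEStronglyMeasurable (fun z : X × X => f z.2) (ν.prod ν) :=
    hfν.comp_quasiMeasurePreserving Measure.quasiMeasurePreserving_snd
  have hF : AEMeasurable (fun y => ∫⁻ z, ‖k y z‖ₑ * ‖f z‖ₑ ∂ν) ν :=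
    AEMeasurable.lintegral_prod_right' (f := fun z : X × X => ‖k z.1 z.2‖ₑ * ‖f z.2‖ₑ)
      (hk.enorm.aemeasurable.mul hfsnd.enorm)
  filter_upwards [hcomp, hjb.ae_lintegral_lt_top hD hj hw hw0 hF
    (ne_top_of_le_ne_top (ENNReal.mul_ne_top hC hfin) (hkb _ hfν.enorm))] with x hx hlt
  have hjx : Measurable (j x) := hj.comp measurable_prodMk_left
  have hmeas : AEStronglyMeasurable (Function.uncurry fun y z => j x y * (k y z * f z))
      (ν.prod ν) :=
    (hjx.comp measurable_fst).aestronglyMeasurable.mul (hk.aestronglyMeasurable.mul hfsnd)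
  have hint : Integrable (Function.uncurry fun y z => j x y * (k y z * f z)) (ν.prod ν) := by
    refine ⟨hmeas, ?_⟩
    rw [HasFiniteIntegral, lintegral_prod _ hmeas.enorm]
    convert hlt using 1
    refine lintegral_congr fun y => ?_
    have hky : Measurable (k y) := hk.comp measurable_prodMk_left
    have hkf : AEMeasurable (fun z => ‖k y z‖ₑ * ‖f z‖ₑ) ν :=
      hky.enorm.aemeasurable.mul hfν.enorm
    rw [← lintegral_const_mul'' _ hkf]
    simp [enorm_mul]
  calc ∫ y, j x y * ∫ z, k y z * f z ∂ν ∂ν = ∫ y, ∫ z, j x y * (k y z * f z) ∂ν ∂ν := by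
        simp_rw [integral_const_mul]
    _ = ∫ z, ∫ y, j x y * (k y z * f z) ∂ν ∂ν := integral_integral_swap hint
    _ = ∫ z, l x z * f z ∂ν := by
        refine integral_congr_ae ?_
        filter_upwards [hx] with z hz
        rw [← hz, ← integral_mul_const]
        simp_rw [mul_assoc]

end SchurBound

end Schur

section Kernel

open ProbabilityTheory
open scoped ENNReal NNReal

/-- The heat kernel of the Dirichlet Laplacian on the half-line. -/
noncomputable def dirichletHeatKernel (t ξ η : ℝ) : ℝ :=
  (1 / Real.sqrt (4 * Real.pi * t)) *
    (Real.exp (-(ξ - η) ^ 2 / (4 * t)) - Real.exp (-(ξ + η) ^ 2 / (4 * t)))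

theorem dirichletHeatKernel_comm (t ξ η : ℝ) :
    dirichletHeatKernel t ξ η = dirichletHeatKernel t η ξ := by
  simp only [dirichletHeatKernel]
  rw [show (ξ - η) ^ 2 = (η - ξ) ^ 2 by ring, add_comm ξ η]

theorem measurable_dirichletHeatKernel (t : ℝ) :
    Measurable (Function.uncurry (dirichletHeatKernel t)) := by
  unfold dirichletHeatKernel Function.uncurry
  fun_prop

theorem gaussianPDFReal_two_mul {t : ℝ} (ht : 0 < t) (ξ η : ℝ) :
    gaussianPDFReal ξ (2 * t).toNNReal η =
      1 / Real.sqrt (4 * Real.pi * t) * Real.exp (-(ξ - η) ^ 2 / (4 * t)) := by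
  rw [gaussianPDFReal, Real.coe_toNNReal _ (by positivity), one_div]
  congr 3 <;> ring_nf

theorem dirichletHeatKernel_eq_sub {t : ℝ} (ht : 0 < t) (ξ η : ℝ) :
    dirichletHeatKernel t ξ η =
      gaussianPDFReal ξ (2 * t).toNNReal η - gaussianPDFReal (-ξ) (2 * t).toNNReal η := by
  rw [gaussianPDFReal_two_mul ht, gaussianPDFReal_two_mul ht, dirichletHeatKernel, mul_sub]
  ring_nf

theorem dirichletHeatKernel_neg_right (t ξ η : ℝ) :
    dirichletHeatKernel t ξ (-η) = -dirichletHeatKernel t ξ η := by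
  simp only [dirichletHeatKernel, sub_neg_eq_add, ← sub_eq_add_neg]
  ring

theorem dirichletHeatKernel_nonneg {t ξ η : ℝ} (ht : 0 < t) (hξ : 0 < ξ) (hη : 0 < η) :
    0 ≤ dirichletHeatKernel t ξ η := by
  refine mul_nonneg (by positivity) (sub_nonneg.2 (Real.exp_le_exp.2 ?_))
  rw [div_le_div_iff_of_pos_right (by positivity)]
  nlinarith [mul_pos hξ hη]

theorem dirichletHeatKernel_le_gaussianPDFReal {t : ℝ} (ht : 0 < t) (ξ η : ℝ) :
    dirichletHeatKernel t ξ η ≤ gaussianPDFReal ξ (2 * t).toNNReal η := by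
  rw [dirichletHeatKernel_eq_sub ht]
  linarith [gaussianPDFReal_nonneg (-ξ) (2 * t).toNNReal η]

theorem two_mul_toNNReal_ne_zero {t : ℝ} (ht : 0 < t) : (2 * t).toNNReal ≠ 0 :=
  (Real.toNNReal_pos.2 (by positivity)).ne'

theorem cube_mul_exp_neg_sq_div_le (a : ℝ) :
    a ^ 3 * Real.exp (-(a ^ 2 / 16)) ≤ 513 := by
  have h1 : (a ^ 2 / 16) ^ 2 / 2 ≤ Real.exp (a ^ 2 / 16) := by
    have := Real.quadratic_le_exp_of_nonneg (x := a ^ 2 / 16) (by positivity)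
    nlinarith [sq_nonneg a]
  have h2 : 1 ≤ Real.exp (a ^ 2 / 16) := Real.one_le_exp (by positivity)
  rw [Real.exp_neg, ← div_eq_mul_inv, div_le_iff₀ (Real.exp_pos _)]
  nlinarith [sq_nonneg (a - 1), sq_nonneg (a ^ 2 - 1), sq_nonneg (a * (a - 1))]

/-- Away from the diagonal, the Dirichlet heat kernel is bounded uniformly in time. -/
theorem dirichletHeatKernel_le_of_le_half {t ξ η : ℝ} (ht : 0 < t) (hη : 0 < η)
    (hηξ : η ≤ ξ / 2) : dirichletHeatKernel t ξ η ≤ 513 * η / ξ ^ 2 := by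
  have hξ : 0 < ξ := by linarith
  obtain ⟨r, hr, rfl⟩ : ∃ r : ℝ, 0 < r ∧ r ^ 2 = t := ⟨√t, Real.sqrt_pos.2 ht, Real.sq_sqrt ht.le⟩
  have hfac : Real.exp (-(ξ + η) ^ 2 / (4 * r ^ 2)) =
      Real.exp (-(ξ - η) ^ 2 / (4 * r ^ 2)) * Real.exp (-(ξ * η / r ^ 2)) := by
    rw [← Real.exp_add]; congr 1; field_simp; ring
  have hlin : 1 - Real.exp (-(ξ * η / r ^ 2)) ≤ ξ * η / r ^ 2 := by
    linarith [Real.add_one_le_exp (-(ξ * η / r ^ 2))]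
  have hlin0 : 0 ≤ 1 - Real.exp (-(ξ * η / r ^ 2)) :=
    sub_nonneg.2 (Real.exp_le_one_iff.2 (neg_nonpos.2 (by positivity)))
  have hexp : Real.exp (-(ξ - η) ^ 2 / (4 * r ^ 2)) ≤ Real.exp (-((ξ / r) ^ 2 / 16)) := by
    refine Real.exp_le_exp.2 ?_
    rw [div_pow, neg_div, neg_le_neg_iff, div_div, div_le_div_iff₀ (by positivity) (by positivity)]
    have : ξ ^ 2 ≤ 4 * (ξ - η) ^ 2 := by nlinarith
    nlinarith [sq_nonneg r]
  have hpre : 1 / √(4 * Real.pi * r ^ 2) ≤ 1 / r := by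
    refine one_div_le_one_div_of_le hr (Real.le_sqrt_of_sq_le ?_)
    nlinarith [Real.pi_gt_three, sq_nonneg r]
  calc dirichletHeatKernel (r ^ 2) ξ η
      = 1 / √(4 * Real.pi * r ^ 2) * (Real.exp (-(ξ - η) ^ 2 / (4 * r ^ 2)) *
          (1 - Real.exp (-(ξ * η / r ^ 2)))) := by
        rw [dirichletHeatKernel, hfac]; ring
    _ ≤ 1 / r * (Real.exp (-((ξ / r) ^ 2 / 16)) * (ξ * η / r ^ 2)) := by gcongr
    _ = ((ξ / r) ^ 3 * Real.exp (-((ξ / r) ^ 2 / 16))) * (η / ξ ^ 2) := by field_simp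
    _ ≤ 513 * (η / ξ ^ 2) := by
        gcongr
        exact cube_mul_exp_neg_sq_div_le _
    _ = _ := by ring

theorem setIntegral_Ioi_zero_of_even {f : ℝ → ℝ} (hf : ∀ x, f (-x) = f x) :
    ∫ x in Ioi (0 : ℝ), f x = (∫ x, f x) / 2 := by
  have h := integral_comp_abs (f := f)
  have habs : ∀ x, f |x| = f x := fun x => by
    rcases abs_choice x with h | h <;> rw [h]
    exact hf x
  simp_rw [habs] at h
  rw [h]; ring

theorem gaussianPDFReal_mul_gaussianPDFReal {u v : ℝ≥0} (hu : u ≠ 0) (hv : v ≠ 0) (x z y : ℝ) :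
    gaussianPDFReal x u y * gaussianPDFReal z v y =
      gaussianPDFReal x (u + v) z *
        gaussianPDFReal ((x * v + z * u) / (u + v)) (u * v / (u + v)) y := by
  have hu' : (0 : ℝ) < u := by positivity
  have hv' : (0 : ℝ) < v := by positivity
  simp only [gaussianPDFReal, NNReal.coe_add, NNReal.coe_mul, NNReal.coe_div]
  rw [mul_mul_mul_comm, mul_mul_mul_comm (√(2 * Real.pi * (u + v)))⁻¹, ← mul_inv, ← mul_inv,
    ← Real.sqrt_mul (by positivity), ← Real.sqrt_mul (by positivity), ← Real.exp_add, ← Real.exp_add]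
  congr 1
  · congr 2; field_simp
  · congr 1; field_simp; ring

theorem integrable_gaussianPDFReal_mul {u v : ℝ≥0} (hu : u ≠ 0) (hv : v ≠ 0) (x z : ℝ) :
    Integrable fun y => gaussianPDFReal x u y * gaussianPDFReal z v y := by
  simp_rw [gaussianPDFReal_mul_gaussianPDFReal hu hv]
  exact (integrable_gaussianPDFReal _ _).const_mul _

theorem integral_gaussianPDFReal_mul {u v : ℝ≥0} (hu : u ≠ 0) (hv : v ≠ 0) (x z : ℝ) :
    ∫ y, gaussianPDFReal x u y * gaussianPDFReal z v y = gaussianPDFReal x (u + v) z := by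
  simp_rw [gaussianPDFReal_mul_gaussianPDFReal hu hv]
  rw [integral_const_mul, integral_gaussianPDFReal_eq_one _ (by positivity), mul_one]

theorem integrable_gaussianPDFReal_mul_id {v : ℝ≥0} (hv : v ≠ 0) (x : ℝ) :
    Integrable fun y => gaussianPDFReal x v y * y := by
  have h : Integrable (fun y : ℝ => y) (gaussianReal x v) :=
    (memLp_id_gaussianReal (μ := x) (v := v) 1).integrable (by simp)
  rw [gaussianReal_of_var_ne_zero _ hv, integrable_withDensity_iff_integrable_smul'
    (measurable_gaussianPDF _ _) (.of_forall fun _ => gaussianPDF_lt_top)] at h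
  simpa using h

theorem integral_gaussianPDFReal_mul_id {v : ℝ≥0} (hv : v ≠ 0) (x : ℝ) :
    ∫ y, gaussianPDFReal x v y * y = x := by
  simpa using (integral_gaussianReal_eq_integral_smul (μ := x) (f := fun y => y) hv).symm.trans
    integral_id_gaussianReal

/-- The Chapman–Kolmogorov identity for the Dirichlet heat kernel. -/
theorem integral_dirichletHeatKernel_mul {s t : ℝ} (hs : 0 < s) (ht : 0 < t) (ξ ζ : ℝ) :
    ∫ η in Ioi (0 : ℝ), dirichletHeatKernel s ξ η * dirichletHeatKernel t η ζ =
      dirichletHeatKernel (s + t) ξ ζ := by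
  have hs' := two_mul_toNNReal_ne_zero hs
  have ht' := two_mul_toNNReal_ne_zero ht
  have hadd : (2 * s).toNNReal + (2 * t).toNNReal = (2 * (s + t)).toNNReal := by
    rw [← Real.toNNReal_add (by positivity) (by positivity), mul_add]
  simp_rw [dirichletHeatKernel_comm t _ ζ]
  rw [setIntegral_Ioi_zero_of_even fun η => by simp [dirichletHeatKernel_neg_right]]
  simp_rw [dirichletHeatKernel_eq_sub hs, dirichletHeatKernel_eq_sub ht, sub_mul, mul_sub]
  have hint := integrable_gaussianPDFReal_mul hs' ht'
  have hint₂ (x : ℝ) : Integrable fun y =>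
      gaussianPDFReal x (2 * s).toNNReal y * gaussianPDFReal ζ (2 * t).toNNReal y -
        gaussianPDFReal x (2 * s).toNNReal y * gaussianPDFReal (-ζ) (2 * t).toNNReal y :=
    (hint x ζ).sub (hint x (-ζ))
  rw [integral_sub (hint₂ _) (hint₂ _),
    integral_sub (hint _ _) (hint _ _), integral_sub (hint _ _) (hint _ _)]
  simp_rw [integral_gaussianPDFReal_mul hs' ht', hadd]
  have hst : 0 < s + t := by positivity
  rw [dirichletHeatKernel_eq_sub hst]
  simp_rw [gaussianPDFReal_two_mul hst]
  rw [show (-ξ - -ζ) ^ 2 = (ξ - ζ) ^ 2 by ring, show (ξ - -ζ) ^ 2 = (-ξ - ζ) ^ 2 by ring]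
  ring

theorem integral_dirichletHeatKernel_mul_id {t : ℝ} (ht : 0 < t) (ξ : ℝ) :
    ∫ η in Ioi (0 : ℝ), dirichletHeatKernel t ξ η * η = ξ := by
  have ht' := two_mul_toNNReal_ne_zero ht
  rw [setIntegral_Ioi_zero_of_even fun η => by simp [dirichletHeatKernel_neg_right]]
  simp_rw [dirichletHeatKernel_eq_sub ht, sub_mul]
  rw [integral_sub (integrable_gaussianPDFReal_mul_id ht' _)
    (integrable_gaussianPDFReal_mul_id ht' _), integral_gaussianPDFReal_mul_id ht',
    integral_gaussianPDFReal_mul_id ht']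
  ring

theorem enorm_dirichletHeatKernel_le {t ξ η : ℝ} (ht : 0 < t) (hξ : 0 < ξ) (hη : 0 < η) :
    ‖dirichletHeatKernel t ξ η‖ₑ ≤ ENNReal.ofReal (gaussianPDFReal ξ (2 * t).toNNReal η) := by
  rw [Real.enorm_of_nonneg (dirichletHeatKernel_nonneg ht hξ hη)]
  exact ENNReal.ofReal_le_ofReal (dirichletHeatKernel_le_gaussianPDFReal ht ξ η)

theorem setLIntegral_enorm_dirichletHeatKernel_le_one {t ξ : ℝ} (ht : 0 < t) (hξ : 0 < ξ) :
    ∫⁻ η in Ioi (0 : ℝ), ‖dirichletHeatKernel t ξ η‖ₑ ≤ 1 := by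
  calc ∫⁻ η in Ioi (0 : ℝ), ‖dirichletHeatKernel t ξ η‖ₑ
      ≤ ∫⁻ η in Ioi (0 : ℝ), ENNReal.ofReal (gaussianPDFReal ξ (2 * t).toNNReal η) :=
        setLIntegral_mono' measurableSet_Ioi fun η hη => enorm_dirichletHeatKernel_le ht hξ hη
    _ ≤ ∫⁻ η, ENNReal.ofReal (gaussianPDFReal ξ (2 * t).toNNReal η) := setLIntegral_le_lintegral _ _
    _ = 1 := lintegral_gaussianPDFReal_eq_one _ (two_mul_toNNReal_ne_zero ht)

theorem setLIntegral_enorm_dirichletHeatKernel_mul_id {t ξ : ℝ} (ht : 0 < t) (hξ : 0 < ξ) :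
    ∫⁻ η in Ioi (0 : ℝ), ‖dirichletHeatKernel t ξ η‖ₑ * ENNReal.ofReal η = ENNReal.ofReal ξ := by
  have ht' := two_mul_toNNReal_ne_zero ht
  have hint : Integrable fun η => dirichletHeatKernel t ξ η * η := by
    simp_rw [dirichletHeatKernel_eq_sub ht, sub_mul]
    exact (integrable_gaussianPDFReal_mul_id ht' _).sub (integrable_gaussianPDFReal_mul_id ht' _)
  conv_rhs => rw [← integral_dirichletHeatKernel_mul_id ht ξ]
  rw [ofReal_integral_eq_lintegral_ofReal hint.integrableOn]
  · refine setLIntegral_congr_fun measurableSet_Ioi fun η hη => ?_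
    have hK := dirichletHeatKernel_nonneg ht hξ hη
    simp only [Real.enorm_of_nonneg hK, ENNReal.ofReal_mul hK]
  · filter_upwards [ae_restrict_mem measurableSet_Ioi] with η hη
    exact mul_nonneg (dirichletHeatKernel_nonneg ht hξ hη) (le_of_lt hη)

theorem setLIntegral_enorm_dirichletHeatKernel_mul_min_le {t ξ : ℝ} (ht : 0 < t) (hξ : 0 < ξ) :
    ∫⁻ η in Ioi (0 : ℝ), ‖dirichletHeatKernel t ξ η‖ₑ * ENNReal.ofReal (min 1 η) ≤
      ENNReal.ofReal (min 1 ξ) := by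
  rw [ENNReal.ofReal_min]
  refine le_min ?_ ?_
  · rw [ENNReal.ofReal_one]
    refine le_trans (lintegral_mono fun η => ?_)
      (setLIntegral_enorm_dirichletHeatKernel_le_one ht hξ)
    refine mul_le_of_le_one_right' ?_
    exact ENNReal.ofReal_le_one.2 (min_le_left _ _)
  · rw [← setLIntegral_enorm_dirichletHeatKernel_mul_id ht hξ]
    gcongr
    exact min_le_right _ _

end Kernel

section Weight

open ProbabilityTheory
open scoped ENNReal NNReal

theorem mul_max_one_rpow_neg_le {α η ξ : ℝ} (hα : α ≤ 1) (hη : 0 < η) (hηξ : η ≤ ξ) :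
    η * max 1 (η ^ (-α)) ≤ ξ * max 1 (ξ ^ (-α)) := by
  have key : ∀ x : ℝ, 0 < x → x * max 1 (x ^ (-α)) = max x (x ^ (1 - α)) := fun x hx => by
    rw [mul_max_of_nonneg _ _ hx.le, mul_one, sub_eq_add_neg, Real.rpow_add hx, Real.rpow_one]
  rw [key η hη, key ξ (hη.trans_le hηξ)]
  exact max_le_max hηξ (Real.rpow_le_rpow hη.le hηξ (by linarith))

theorem max_one_rpow_neg_le_two_mul {α η ξ : ℝ} (hα0 : 0 ≤ α) (hα : α ≤ 1) (hξ : 0 < ξ)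
    (hηξ : ξ / 2 ≤ η) : max 1 (η ^ (-α)) ≤ 2 * max 1 (ξ ^ (-α)) := by
  have hη : 0 < η := by linarith
  have hp : 1 ≤ max 1 (ξ ^ (-α)) := le_max_left _ _
  rcases le_total η ξ with h | h
  · have := mul_max_one_rpow_neg_le hα hη h
    have h2 : η * max 1 (η ^ (-α)) ≤ η * (2 * max 1 (ξ ^ (-α))) := by nlinarith
    exact le_of_mul_le_mul_left h2 hη
  · have : max 1 (η ^ (-α)) ≤ max 1 (ξ ^ (-α)) :=
      max_le_max le_rfl (Real.rpow_le_rpow_of_nonpos hξ h (by linarith))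
    linarith

theorem min_one_rpow_mul_max_one_rpow_neg {α ξ : ℝ} (hα : 0 ≤ α) (hξ : 0 < ξ) :
    min 1 (ξ ^ (1 + α)) * max 1 (ξ ^ (-α)) = min 1 ξ := by
  rcases le_total ξ 1 with h | h
  · rw [min_eq_right (Real.rpow_le_one hξ.le h (by linarith)),
      max_eq_right (Real.one_le_rpow_of_pos_of_le_one_of_nonpos hξ h (by linarith)),
      ← Real.rpow_add hξ, min_eq_right h]
    simp
  · rw [min_eq_left (Real.one_le_rpow h (by linarith)),
      max_eq_left (Real.rpow_le_one_of_one_le_of_nonpos h (by linarith)), min_eq_left h, one_mul]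

theorem dirichletHeatKernel_mul_weight_le {α t ξ η : ℝ} (hα : α ∈ Ioo (0 : ℝ) 1) (ht : 0 < t)
    (hξ : 0 < ξ) (hη : 0 < η) :
    dirichletHeatKernel t ξ η * max 1 (η ^ (-α)) ≤
      2 * max 1 (ξ ^ (-α)) * gaussianPDFReal ξ (2 * t).toNNReal η +
        (Ioc 0 ξ).indicator (fun _ => 513 / ξ * max 1 (ξ ^ (-α))) η := by
  have hpξ : 1 ≤ max 1 (ξ ^ (-α)) := le_max_left _ _
  have hpη : 1 ≤ max 1 (η ^ (-α)) := le_max_left _ _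
  have hg := gaussianPDFReal_nonneg ξ (2 * t).toNNReal η
  rcases le_total η (ξ / 2) with h | h
  · rw [indicator_of_mem (show η ∈ Ioc 0 ξ from ⟨hη, by linarith⟩)]
    have hK := dirichletHeatKernel_le_of_le_half ht hη h
    have hm := mul_max_one_rpow_neg_le hα.2.le hη (show η ≤ ξ by linarith)
    calc dirichletHeatKernel t ξ η * max 1 (η ^ (-α))
        ≤ 513 * η / ξ ^ 2 * max 1 (η ^ (-α)) := by gcongr
      _ = 513 / ξ ^ 2 * (η * max 1 (η ^ (-α))) := by ring
      _ ≤ 513 / ξ ^ 2 * (ξ * max 1 (ξ ^ (-α))) := by gcongr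
      _ = 513 / ξ * max 1 (ξ ^ (-α)) := by field_simp
      _ ≤ _ := le_add_of_nonneg_left (by positivity)
  · calc dirichletHeatKernel t ξ η * max 1 (η ^ (-α))
        ≤ gaussianPDFReal ξ (2 * t).toNNReal η * (2 * max 1 (ξ ^ (-α))) := by
          gcongr
          · exact dirichletHeatKernel_le_gaussianPDFReal ht ξ η
          · exact max_one_rpow_neg_le_two_mul hα.1.le hα.2.le hξ h
      _ = 2 * max 1 (ξ ^ (-α)) * gaussianPDFReal ξ (2 * t).toNNReal η := by ring
      _ ≤ _ := le_add_of_nonneg_right (indicator_nonneg (fun _ _ => by positivity) _)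

theorem setLIntegral_enorm_dirichletHeatKernel_mul_weight_le {α t ξ : ℝ}
    (hα : α ∈ Ioo (0 : ℝ) 1) (ht : 0 < t) (hξ : 0 < ξ) :
    ∫⁻ η in Ioi (0 : ℝ), ‖dirichletHeatKernel t ξ η‖ₑ * ENNReal.ofReal (max 1 (η ^ (-α))) ≤
      515 * ENNReal.ofReal (max 1 (ξ ^ (-α))) := by
  set P := max 1 (ξ ^ (-α)) with hP
  have hP0 : 0 < P := zero_lt_one.trans_le (le_max_left _ _)
  calc ∫⁻ η in Ioi (0 : ℝ), ‖dirichletHeatKernel t ξ η‖ₑ * ENNReal.ofReal (max 1 (η ^ (-α)))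
      ≤ ∫⁻ η in Ioi (0 : ℝ), (ENNReal.ofReal (2 * P) *
          ENNReal.ofReal (gaussianPDFReal ξ (2 * t).toNNReal η) +
          (Ioc 0 ξ).indicator (fun _ => ENNReal.ofReal (513 / ξ * P)) η) := by
        refine setLIntegral_mono' measurableSet_Ioi fun η hη => ?_
        have hK := dirichletHeatKernel_nonneg ht hξ hη
        rw [Real.enorm_of_nonneg hK, ← ENNReal.ofReal_mul hK, ← ENNReal.ofReal_mul (by positivity)]
        refine (ENNReal.ofReal_le_ofReal
          (dirichletHeatKernel_mul_weight_le hα ht hξ hη)).trans (ENNReal.ofReal_add_le.trans ?_)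
        gcongr
        by_cases h : η ∈ Ioc 0 ξ <;> simp [h, hP]
    _ ≤ ∫⁻ η, (ENNReal.ofReal (2 * P) *
          ENNReal.ofReal (gaussianPDFReal ξ (2 * t).toNNReal η) +
          (Ioc 0 ξ).indicator (fun _ => ENNReal.ofReal (513 / ξ * P)) η) :=
        setLIntegral_le_lintegral _ _
    _ = ENNReal.ofReal (2 * P) + ENNReal.ofReal (513 / ξ * P) * ENNReal.ofReal ξ := by
        rw [lintegral_add_right _ (measurable_const.indicator measurableSet_Ioc),
          lintegral_const_mul _ (measurable_gaussianPDFReal _ _).ennreal_ofReal,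
          lintegral_gaussianPDFReal_eq_one _ (two_mul_toNNReal_ne_zero ht), mul_one,
          lintegral_indicator_const measurableSet_Ioc, Real.volume_Ioc, sub_zero]
    _ = 515 * ENNReal.ofReal P := by
        rw [← ENNReal.ofReal_mul (by positivity), ← ENNReal.ofReal_add (by positivity)
          (by positivity), show (515 : ℝ≥0∞) = ENNReal.ofReal 515 by simp,
          ← ENNReal.ofReal_mul (by norm_num)]
        congr 1
        field_simp
        ring

theorem measurable_ofReal_min_one_rpow (β : ℝ) :
    Measurable fun ξ : ℝ => ENNReal.ofReal (min 1 (ξ ^ β)) := by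
  fun_prop

theorem ae_ofReal_min_one_rpow_ne_zero (β : ℝ) :
    ∀ᵐ ξ ∂volume.restrict (Ioi (0 : ℝ)), ENNReal.ofReal (min 1 (ξ ^ β)) ≠ 0 := by
  filter_upwards [ae_restrict_mem measurableSet_Ioi] with ξ hξ
  exact (ENNReal.ofReal_pos.2 (lt_min one_pos (Real.rpow_pos_of_pos hξ _))).ne'

theorem schurBound_dirichletHeatKernel {α t : ℝ} (hα : α ∈ Ioo (0 : ℝ) 1) (ht : 0 < t) :
    SchurBound (volume.restrict (Ioi (0 : ℝ)))
      (fun ξ => ENNReal.ofReal (min 1 (ξ ^ (1 + α)))) (dirichletHeatKernel t) 515 := by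
  intro F hF
  have hwp : ∀ ξ ∈ Ioi (0 : ℝ), ENNReal.ofReal (min 1 (ξ ^ (1 + α))) *
      ENNReal.ofReal (max 1 (ξ ^ (-α))) = ENNReal.ofReal (min 1 ξ) := fun ξ hξ => by
    rw [← ENNReal.ofReal_mul (le_min zero_le_one (Real.rpow_nonneg (le_of_lt hξ) _)),
      min_one_rpow_mul_max_one_rpow_neg hα.1.le hξ]
  have h := lintegral_sq_lintegral_mul_le (ν := volume.restrict (Ioi (0 : ℝ)))
    (k := fun ξ η => ‖dirichletHeatKernel t ξ η‖ₑ)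
    (p := fun ξ => ENNReal.ofReal (max 1 (ξ ^ (-α)))) (C₁ := 515) (C₂ := 1)
    (measurable_dirichletHeatKernel t).enorm (by fun_prop)
    (measurable_ofReal_min_one_rpow (1 + α))
    (.of_forall fun ξ => (ENNReal.ofReal_pos.2 (by positivity)).ne')
    (.of_forall fun ξ => ENNReal.ofReal_ne_top) hF ?_ ?_
  · simpa using h
  · filter_upwards [ae_restrict_mem measurableSet_Ioi] with ξ hξ
    exact setLIntegral_enorm_dirichletHeatKernel_mul_weight_le hα ht hξ
  · filter_upwards [ae_restrict_mem measurableSet_Ioi] with η hη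
    rw [hwp η hη, one_mul]
    refine le_trans (le_of_eq ?_) (setLIntegral_enorm_dirichletHeatKernel_mul_min_le ht hη)
    refine setLIntegral_congr_fun measurableSet_Ioi fun ξ hξ => ?_
    simp only [hwp ξ hξ, dirichletHeatKernel_comm t ξ η]

end Weight

section Continuity

open ProbabilityTheory
open scoped ENNReal NNReal Topology

/-- Gaussian convolution is an approximation of the identity as the variance tends to zero. -/
theorem tendsto_integral_gaussianPDFReal_mul {h : ℝ → ℝ} {x : ℝ} (hint : Integrable h)
    (hcont : ContinuousAt h x) :
    Tendsto (fun t : ℝ => ∫ y, gaussianPDFReal x (2 * t).toNNReal y * h y) (𝓝[>] 0)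
      (𝓝 (h x)) := by
  have hdecay : Tendsto (fun y : ℝ => ‖y‖ ^ Module.finrank ℝ ℝ *
      gaussianPDFReal 0 (2 * 1 : ℝ).toNNReal y) (Bornology.cobounded ℝ) (𝓝 0) := by
    have := (tendsto_rpow_abs_mul_exp_neg_mul_sq_cocompact (a := 1 / 4) (by norm_num) 1).const_mul
      (1 / √(4 * Real.pi * 1))
    rw [mul_zero] at this
    rw [Metric.cobounded_eq_cocompact]
    refine this.congr fun y => ?_
    rw [gaussianPDFReal_two_mul one_pos, Module.finrank_self, pow_one, Real.rpow_one,
      Real.norm_eq_abs]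
    ring_nf
  have hpeak := tendsto_integral_comp_smul_smul_of_integrable' (μ := volume) (x₀ := x)
    (fun y => gaussianPDFReal_nonneg 0 (2 * 1 : ℝ).toNNReal y)
    (integral_gaussianPDFReal_eq_one 0 (two_mul_toNNReal_ne_zero one_pos)) hdecay hint hcont
  have hscale : Tendsto (fun t : ℝ => (√t)⁻¹) (𝓝[>] 0) atTop := by
    refine tendsto_inv_nhdsGT_zero.comp (tendsto_nhdsWithin_iff.2 ⟨?_, ?_⟩)
    · simpa using (Real.continuous_sqrt.tendsto 0).mono_left nhdsWithin_le_nhds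
    · filter_upwards [self_mem_nhdsWithin] with t ht using Real.sqrt_pos.2 ht
  refine (hpeak.comp hscale).congr' ?_
  filter_upwards [self_mem_nhdsWithin] with t (ht : 0 < t)
  refine integral_congr_ae (.of_forall fun y => ?_)
  have hr : 0 < √t := Real.sqrt_pos.2 ht
  simp only [gaussianPDFReal_two_mul one_pos, gaussianPDFReal_two_mul ht, Module.finrank_self,
    pow_one, smul_eq_mul]
  have hpre : 1 / √(4 * Real.pi * t) = (√t)⁻¹ * (1 / √(4 * Real.pi * 1)) := by
    rw [mul_one, Real.sqrt_mul (by positivity)]; field_simp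
  have hexp : -(0 - (√t)⁻¹ * (x - y)) ^ 2 / (4 * 1) = -(x - y) ^ 2 / (4 * t) := by
    rw [zero_sub, neg_sq, mul_pow, inv_pow, Real.sq_sqrt ht.le]; field_simp
  rw [hpre, hexp]
  ring

theorem tendsto_integral_dirichletHeatKernel_mul {g : ℝ → ℝ} (hg : Integrable g)
    (hcont : Continuous g) {ξ : ℝ} (hξ : 0 < ξ) :
    Tendsto (fun t : ℝ => ∫ η in Ioi (0 : ℝ), dirichletHeatKernel t ξ η * g η) (𝓝[>] 0)
      (𝓝 (g ξ)) := by
  have hint : Integrable ((Ioi (0 : ℝ)).indicator g) := hg.indicator measurableSet_Ioi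
  have hpos : (Ioi (0 : ℝ)).indicator g =ᶠ[𝓝 ξ] g := by
    filter_upwards [Ioi_mem_nhds hξ] with y hy using indicator_of_mem hy g
  have hneg : (Ioi (0 : ℝ)).indicator g =ᶠ[𝓝 (-ξ)] fun _ => 0 := by
    filter_upwards [Iio_mem_nhds (neg_neg_of_pos hξ)] with y hy
    exact indicator_of_notMem (not_lt.2 (le_of_lt hy)) g
  have h1 := tendsto_integral_gaussianPDFReal_mul hint (hcont.continuousAt.congr hpos.symm)
  have h2 := tendsto_integral_gaussianPDFReal_mul hint (continuousAt_const.congr hneg.symm)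
  have h3 := h1.sub h2
  rw [hpos.eq_of_nhds, hneg.eq_of_nhds, sub_zero] at h3
  refine h3.congr' ?_
  filter_upwards [self_mem_nhdsWithin] with t (ht : 0 < t)
  have hb : ∀ x : ℝ, Integrable fun y =>
      gaussianPDFReal x (2 * t).toNNReal y * (Ioi (0 : ℝ)).indicator g y := fun x => by
    refine hint.bdd_mul (c := 1 / √(4 * Real.pi * t))
      (measurable_gaussianPDFReal _ _).aestronglyMeasurable (.of_forall fun y => ?_)
    rw [Real.norm_of_nonneg (gaussianPDFReal_nonneg _ _ _), gaussianPDFReal_two_mul ht]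
    refine mul_le_of_le_one_right (by positivity) (Real.exp_le_one_iff.2 ?_)
    rw [neg_div]
    exact neg_nonpos.2 (by positivity)
  rw [← integral_sub (hb _) (hb _), ← integral_indicator measurableSet_Ioi]
  refine integral_congr_ae (.of_forall fun y => ?_)
  by_cases hy : y ∈ Ioi (0 : ℝ) <;> simp [hy, dirichletHeatKernel_eq_sub ht, sub_mul]

theorem gaussianPDFReal_mul_exp_neg {t : ℝ} (ht : 0 < t) (ξ η : ℝ) :
    gaussianPDFReal ξ (2 * t).toNNReal η * Real.exp (-η) =
      Real.exp (t - ξ) * gaussianPDFReal (ξ - 2 * t) (2 * t).toNNReal η := by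
  rw [gaussianPDFReal_two_mul ht, gaussianPDFReal_two_mul ht, mul_assoc, ← Real.exp_add,
    mul_left_comm, ← Real.exp_add]
  congr 2
  field_simp
  ring

theorem norm_integral_dirichletHeatKernel_mul_le {g : ℝ → ℝ} {M t ξ : ℝ}
    (hg : ∀ η, 0 < η → |g η| ≤ M * Real.exp (-η)) (ht : 0 < t) (hξ : 0 < ξ) :
    ‖∫ η in Ioi (0 : ℝ), dirichletHeatKernel t ξ η * g η‖ ≤ M * Real.exp (t - ξ) := by
  have hM : 0 ≤ M := by
    have := (abs_nonneg _).trans (hg 1 one_pos)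
    exact nonneg_of_mul_nonneg_left this (Real.exp_pos _)
  have hint : Integrable fun η =>
      M * Real.exp (t - ξ) * gaussianPDFReal (ξ - 2 * t) (2 * t).toNNReal η :=
    (integrable_gaussianPDFReal _ _).const_mul _
  calc ‖∫ η in Ioi (0 : ℝ), dirichletHeatKernel t ξ η * g η‖
      ≤ ∫ η in Ioi (0 : ℝ),
          M * Real.exp (t - ξ) * gaussianPDFReal (ξ - 2 * t) (2 * t).toNNReal η := by
        refine norm_integral_le_of_norm_le hint.integrableOn ?_
        filter_upwards [ae_restrict_mem measurableSet_Ioi] with η hη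
        rw [norm_mul, Real.norm_of_nonneg (dirichletHeatKernel_nonneg ht hξ hη), mul_assoc,
          ← gaussianPDFReal_mul_exp_neg ht, mul_left_comm]
        exact mul_le_mul (dirichletHeatKernel_le_gaussianPDFReal ht ξ η) (hg η hη)
          (norm_nonneg _) (gaussianPDFReal_nonneg _ _ _)
    _ ≤ ∫ η, M * Real.exp (t - ξ) * gaussianPDFReal (ξ - 2 * t) (2 * t).toNNReal η :=
        setIntegral_le_integral hint
          (.of_forall fun η => mul_nonneg (by positivity) (gaussianPDFReal_nonneg _ _ _))
    _ = M * Real.exp (t - ξ) := by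
        rw [integral_const_mul,
          integral_gaussianPDFReal_eq_one _ (two_mul_toNNReal_ne_zero ht), mul_one]

theorem HasCompactSupport.exists_abs_le_mul_exp_neg {g : ℝ → ℝ} (hg : HasCompactSupport g)
    (hcont : Continuous g) : ∃ M, ∀ η, |g η| ≤ M * Real.exp (-η) := by
  obtain ⟨M, hM⟩ := (hg.mul_right (f' := Real.exp)).exists_bound_of_continuous
    (hcont.mul Real.continuous_exp)
  refine ⟨M, fun η => ?_⟩
  have := hM η
  rw [Pi.mul_apply, norm_mul, Real.norm_eq_abs, Real.norm_of_nonneg (Real.exp_pos _).le] at this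
  rwa [Real.exp_neg, ← div_eq_mul_inv, le_div_iff₀ (Real.exp_pos _)]

theorem withDensity_min_one_rpow_le (β : ℝ) :
    ((volume.restrict (Ioi (0 : ℝ))).withDensity fun ξ => ENNReal.ofReal (min 1 (ξ ^ β))) ≤
      volume.restrict (Ioi (0 : ℝ)) := by
  conv_rhs => rw [← withDensity_one (μ := volume.restrict (Ioi (0 : ℝ)))]
  exact withDensity_mono (.of_forall fun ξ => ENNReal.ofReal_le_one.2 (min_le_left _ _))

theorem tendsto_eLpNorm_dirichletHeatKernel_sub {μ : Measure ℝ}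
    (hμ : μ ≤ volume.restrict (Ioi (0 : ℝ))) {g : ℝ → ℝ} (hg : HasCompactSupport g)
    (hcont : Continuous g) :
    Tendsto (fun t : ℝ => eLpNorm
      ((fun ξ => ∫ η in Ioi (0 : ℝ), dirichletHeatKernel t ξ η * g η) - g) 2 μ)
      (𝓝[>] 0) (𝓝 0) := by
  obtain ⟨M, hM⟩ := hg.exists_abs_le_mul_exp_neg hcont
  have hM0 : 0 ≤ M := by
    have := (abs_nonneg _).trans (hM 1)
    exact nonneg_of_mul_nonneg_left this (Real.exp_pos _)
  have hpos : ∀ᵐ ξ ∂μ, ξ ∈ Ioi (0 : ℝ) :=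
    (Measure.absolutelyContinuous_of_le hμ).ae_le (ae_restrict_mem measurableSet_Ioi)
  have hsq : Tendsto (fun t : ℝ => eLpNorm
      ((fun ξ => ∫ η in Ioi (0 : ℝ), dirichletHeatKernel t ξ η * g η) - g) 2 μ ^ 2)
      (𝓝[>] 0) (𝓝 0) := by
    simp_rw [eLpNorm_two_sq]
    have hdom := tendsto_lintegral_filter_of_dominated_convergence (μ := μ) (l := 𝓝[>] (0 : ℝ))
      (F := fun t ξ => ‖((fun ξ => ∫ η in Ioi (0 : ℝ), dirichletHeatKernel t ξ η * g η) - g) ξ‖ₑ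
        ^ 2) (f := fun _ => 0)
      (fun ξ => ENNReal.ofReal ((M * (Real.exp 1 + 1)) ^ 2 * Real.exp (-2 * ξ))) ?_ ?_ ?_ ?_
    · simpa using hdom
    · refine .of_forall fun t => ?_
      have : StronglyMeasurable fun ξ => ∫ η in Ioi (0 : ℝ), dirichletHeatKernel t ξ η * g η :=
        StronglyMeasurable.integral_prod_right'
          (f := fun z : ℝ × ℝ => dirichletHeatKernel t z.1 z.2 * g z.2)
          ((measurable_dirichletHeatKernel t).mul
            (hcont.measurable.comp measurable_snd)).stronglyMeasurable
      exact ((this.measurable.sub hcont.measurable).enorm.pow_const 2)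
    · filter_upwards [Ioo_mem_nhdsGT (zero_lt_one' ℝ)] with t ht
      filter_upwards [hpos] with ξ hξ
      have h1 := norm_integral_dirichletHeatKernel_mul_le (fun η _ => hM η) ht.1 hξ
      have h2 := hM ξ
      have h3 : Real.exp (t - ξ) ≤ Real.exp 1 * Real.exp (-ξ) := by
        rw [← Real.exp_add]
        exact Real.exp_le_exp.2 (by linarith [ht.2])
      rw [← ofReal_norm, ← ENNReal.ofReal_pow (norm_nonneg _)]
      refine ENNReal.ofReal_le_ofReal ?_
      rw [show (-2 : ℝ) * ξ = -ξ + -ξ by ring, Real.exp_add, ← sq, ← mul_pow]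
      refine pow_le_pow_left₀ (norm_nonneg _) ((norm_sub_le _ _).trans ?_) 2
      rw [Real.norm_eq_abs (g ξ)]
      nlinarith [mul_le_mul_of_nonneg_left h3 hM0]
    · refine ((lintegral_mono' hμ le_rfl).trans_lt ?_).ne
      exact ((integrableOn_exp_mul_Ioi (by norm_num) 0).const_mul _).lintegral_lt_top
    · filter_upwards [hpos] with ξ hξ
      have h := (tendsto_integral_dirichletHeatKernel_mul
        (hcont.integrable_of_hasCompactSupport hg) hcont hξ).sub_const (g ξ)
      have h' := ((ENNReal.continuous_pow 2).tendsto _).comp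
        ((continuous_enorm (E := ℝ)).tendsto _ |>.comp h)
      simpa [Function.comp_def] using h'
  have hroot := ((ENNReal.continuous_rpow_const (y := 1 / 2)).tendsto 0).comp hsq
  rw [ENNReal.zero_rpow_of_pos (by norm_num)] at hroot
  refine hroot.congr fun t => ?_
  rw [Function.comp_apply, ← ENNReal.rpow_natCast, ← ENNReal.rpow_mul]
  norm_num

end Continuity

/-- Proposition 6.1(1): the Dirichlet heat kernel on the half-line defines
a strongly continuous semigroup on the weighted space `L²((0,∞), min(1,ξ^{1+α})dξ)`. -/
theorem dirichlet_heat_semigroup_weighted_L2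
    (α : ℝ) (hα : α ∈ Ioo (0:ℝ) 1) :
    ∃ T : ℝ →
      (Lp ℝ 2 ((volume.restrict (Ioi (0:ℝ))).withDensity
          fun ξ => ENNReal.ofReal (min 1 (ξ ^ (1 + α)))) →L[ℝ]
        Lp ℝ 2 ((volume.restrict (Ioi (0:ℝ))).withDensity
          fun ξ => ENNReal.ofReal (min 1 (ξ ^ (1 + α))))),
      -- T 0 is the identity
      T 0 = ContinuousLinearMap.id ℝ _ ∧
      -- for t > 0, T t is given by the Dirichlet heat kernel
      (∀ t > (0:ℝ), ∀ f, (T t f : ℝ → ℝ)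
          =ᵐ[(volume.restrict (Ioi (0:ℝ))).withDensity
              fun ξ => ENNReal.ofReal (min 1 (ξ ^ (1 + α)))]
        fun ξ => ∫ η in Ioi (0:ℝ),
          ((1 / Real.sqrt (4 * Real.pi * t)) *
            (Real.exp (-(ξ - η) ^ 2 / (4 * t)) - Real.exp (-(ξ + η) ^ 2 / (4 * t)))) *
          (f : ℝ → ℝ) η) ∧
      -- semigroup property
      (∀ s ≥ (0:ℝ), ∀ t ≥ (0:ℝ), T (s + t) = (T s).comp (T t)) ∧
      -- strong continuity at 0
      (∀ f, Tendsto (fun t => T t f) (nhdsWithin 0 (Ioi 0)) (nhds f)) := by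
  set ν := volume.restrict (Ioi (0 : ℝ))
  set w : ℝ → ENNReal := fun ξ => ENNReal.ofReal (min 1 (ξ ^ (1 + α)))
  have hw : Measurable w := measurable_ofReal_min_one_rpow _
  have hw0 : ∀ᵐ ξ ∂ν, w ξ ≠ 0 := ae_ofReal_min_one_rpow_ne_zero _
  have hac := withDensity_absolutelyContinuous ν w
  have hac' := withDensity_absolutelyContinuous' hw.aemeasurable hw0
  have hC : (515 : ENNReal) ≠ ⊤ := by simp
  have hbound : ∀ t : ℝ, 0 < t → SchurBound ν w (dirichletHeatKernel t) 515 :=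
    fun t ht => schurBound_dirichletHeatKernel hα ht
  have hex : ∀ t : ℝ, ∃ T : Lp ℝ 2 (ν.withDensity w) →L[ℝ] Lp ℝ 2 (ν.withDensity w),
      (t = 0 → T = ContinuousLinearMap.id ℝ _) ∧ (0 < t →
        (∀ f, T f =ᵐ[ν.withDensity w] fun ξ => ∫ η, dirichletHeatKernel t ξ η * f η ∂ν) ∧
        ∀ f, ‖T f‖ ≤ ((515 : ENNReal) ^ (1 / 2 : ℝ)).toReal * ‖f‖) := fun t => by
    rcases lt_or_ge 0 t with ht | ht
    · obtain ⟨T, hT⟩ := (hbound t ht).exists_continuousLinearMap hC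
        (measurable_dirichletHeatKernel t) hw hw0
      exact ⟨T, fun h => absurd h ht.ne', fun _ => hT⟩
    · exact ⟨ContinuousLinearMap.id ℝ _, fun _ => rfl, fun h => absurd h ht.not_gt⟩
  choose T hT0 hT using hex
  refine ⟨T, hT0 0 rfl, fun t ht => (hT t ht).1, fun s hs t ht => ?_, fun f => ?_⟩
  · rcases hs.eq_or_lt' with rfl | hs
    · rw [hT0 0 rfl, zero_add, ContinuousLinearMap.id_comp]
    rcases ht.eq_or_lt' with rfl | ht
    · rw [hT0 0 rfl, add_zero, ContinuousLinearMap.comp_id]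
    ext1 f
    refine Lp.ext (((hT (s + t) (add_pos hs ht)).1 f).trans
      (EventuallyEq.trans ?_ ((hT s hs).1 (T t f)).symm))
    refine hac.ae_le ?_
    have hcomp : ∀ᵐ ξ ∂ν, ∀ᵐ ζ ∂ν, ∫ η, dirichletHeatKernel s ξ η * dirichletHeatKernel t η ζ ∂ν =
        dirichletHeatKernel (s + t) ξ ζ :=
      .of_forall fun ξ => .of_forall fun ζ => integral_dirichletHeatKernel_mul hs ht ξ ζ
    filter_upwards [(hbound s hs).integral_integral_comp (hbound t ht) hC hC
      (measurable_dirichletHeatKernel s) (measurable_dirichletHeatKernel t) hw hw0 hcomp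
      (Lp.memLp f)] with ξ hξ
    rw [← hξ]
    refine integral_congr_ae ?_
    filter_upwards [hac'.ae_le ((hT t ht).1 f)] with η hη
    rw [hη]
  · have hμ : ν.withDensity w ≤ ν := withDensity_min_one_rpow_le _
    have : IsLocallyFiniteMeasure (ν.withDensity w) :=
      Measure.isLocallyFiniteMeasure_of_le (hμ.trans Measure.restrict_le_self)
    set B := ((515 : ENNReal) ^ (1 / 2 : ℝ)).toReal
    have hB : 0 ≤ B := ENNReal.toReal_nonneg
    rw [Metric.tendsto_nhds]
    intro ε hε
    have hδ : 0 < ε / (2 * (B + 1)) := by positivity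
    obtain ⟨g, hgs, hfg, hgc, hgm⟩ := (Lp.memLp f).exists_hasCompactSupport_eLpNorm_sub_le
      (by simp) (ENNReal.ofReal_pos.2 hδ).ne'
    have hfg' : ‖f - hgm.toLp g‖ ≤ ε / (2 * (B + 1)) := by
      rw [← Lp.toLp_coeFn f (Lp.memLp f), ← MemLp.toLp_sub, Lp.norm_toLp]
      exact ENNReal.toReal_le_of_le_ofReal hδ.le hfg
    have hTg : Tendsto (fun t => T t (hgm.toLp g)) (nhdsWithin 0 (Ioi 0))
        (nhds (hgm.toLp g)) := by
      rw [Lp.tendsto_Lp_iff_tendsto_eLpNorm]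
      refine (tendsto_eLpNorm_dirichletHeatKernel_sub hμ hgs hgc).congr' ?_
      filter_upwards [self_mem_nhdsWithin] with t ht
      refine eLpNorm_congr_ae (EventuallyEq.sub ?_ .rfl)
      refine EventuallyEq.trans (.of_forall fun ξ => ?_) ((hT t ht).1 (hgm.toLp g)).symm
      refine integral_congr_ae ?_
      filter_upwards [hac'.ae_le hgm.coeFn_toLp] with η hη
      rw [hη]
    filter_upwards [Metric.tendsto_nhds.1 hTg (ε / 2) (half_pos hε), self_mem_nhdsWithin]
      with t hclose ht
    rw [dist_eq_norm] at hclose ⊢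
    have hsplit : T t f - f = T t (f - hgm.toLp g) + (T t (hgm.toLp g) - hgm.toLp g) -
        (f - hgm.toLp g) := by
      rw [map_sub]; abel
    calc ‖T t f - f‖
        ≤ ‖T t (f - hgm.toLp g)‖ + ‖T t (hgm.toLp g) - hgm.toLp g‖ + ‖f - hgm.toLp g‖ := by
          rw [hsplit]
          exact (norm_sub_le _ _).trans (by gcongr; exact norm_add_le _ _)
      _ < B * (ε / (2 * (B + 1))) + ε / 2 + ε / (2 * (B + 1)) := by
          have := ((hT t ht).2 (f - hgm.toLp g)).trans (mul_le_mul_of_nonneg_left hfg' hB)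
          linarith
      _ = ε := by field_simp; ring
end

section
/- Fix α ∈ (0,1) and t > 0, and let ρ(ξ) = min(1, ξ^{1+α}). With G(s,ξ,η) = (4πs)^{-1/2}( e^{-(ξ−η)²/(4s)} − e^{-(ξ+η)²/(4s)} ) the Dirichlet heat kernel on the half-line, its normal derivative at the boundary is (∂G/∂η)(s,ξ,0) = (4πs)^{-1/2} (ξ/s) e^{-ξ²/(4s)}. Then ∫₀^∞ ρ(ξ) ( ∫₀ᵗ ((∂G/∂η)(s,ξ,0))² ds ) dξ = ∫₀^∞ min(1,ξ^{1+α}) ( ∫₀ᵗ (ξ²/(4π s³)) e^{-ξ²/(2s)} ds ) dξ < ∞. -/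
open MeasureTheory Set Real

/-- Exponential decay beats every positive power, with an explicit constant. -/
lemma exp_neg_le_rpow_mul_rpow_neg {p y : ℝ} (hp : 0 < p) (hy : 0 < y) :
    Real.exp (-y) ≤ p ^ p * y ^ (-p) := by
  have h : y / p ≤ Real.exp (y / p) := by linarith [Real.add_one_le_exp (y / p)]
  have h' : y ^ p ≤ p ^ p * Real.exp y := by
    have hpow := Real.rpow_le_rpow (by positivity) h hp.le
    rw [Real.div_rpow hy.le hp.le, ← Real.exp_mul, div_mul_cancel₀ _ hp.ne',
      div_le_iff₀ (by positivity)] at hpow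
    linarith
  rw [Real.exp_neg, Real.rpow_neg hy.le, ← div_eq_mul_inv, le_div_iff₀ (by positivity),
    inv_mul_le_iff₀ (Real.exp_pos y)]
  linarith

/-- The squared normal derivative of the Dirichlet heat kernel at the boundary. -/
lemma sq_dirichlet_kernel_normal_deriv (ξ : ℝ) {s : ℝ} (hs : 0 < s) :
    ((1 / Real.sqrt (4 * π * s)) * (ξ / s) * Real.exp (-ξ ^ 2 / (4 * s))) ^ 2
      = ξ ^ 2 / (4 * π * s ^ 3) * Real.exp (-ξ ^ 2 / (2 * s)) := by
  have hpi := Real.pi_pos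
  rw [mul_pow, mul_pow, div_pow, Real.sq_sqrt (by positivity), ← Real.exp_nat_mul]
  have he : ((2 : ℕ) : ℝ) * (-ξ ^ 2 / (4 * s)) = -ξ ^ 2 / (2 * s) := by
    push_cast
    field_simp
    ring
  rw [he]
  field_simp

/-- Pointwise power bound for the covariance density. -/
lemma covariance_density_le {p ξ s : ℝ} (hp : 0 < p) (hξ : 0 < ξ) (hs : 0 < s) :
    ξ ^ 2 / (4 * π * s ^ 3) * Real.exp (-ξ ^ 2 / (2 * s))
      ≤ p ^ p * 2 ^ p / (4 * π) * ξ ^ (2 - 2 * p) * s ^ (p - 3) := by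
  have hpi := Real.pi_pos
  have h := exp_neg_le_rpow_mul_rpow_neg hp (y := ξ ^ 2 / (2 * s)) (by positivity)
  have hξp : ξ ^ (2 - 2 * p) = ξ ^ 2 / (ξ ^ 2) ^ p := by
    rw [Real.rpow_sub hξ, Real.rpow_mul hξ.le, Real.rpow_two]
  have hsp : s ^ (p - 3) = s ^ p / s ^ 3 := by
    rw [Real.rpow_sub hs]
    norm_cast
  rw [Real.rpow_neg (by positivity), Real.div_rpow (by positivity) (by positivity),
    Real.mul_rpow (by norm_num) hs.le] at h
  rw [neg_div, hξp, hsp]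
  calc ξ ^ 2 / (4 * π * s ^ 3) * Real.exp (-(ξ ^ 2 / (2 * s)))
      ≤ ξ ^ 2 / (4 * π * s ^ 3) * (p ^ p * ((ξ ^ 2) ^ p / (2 ^ p * s ^ p))⁻¹) := by gcongr
    _ = _ := by field_simp

/-- Power bound for the time-integrated covariance density. -/
lemma integral_covariance_density_le {p ξ t : ℝ} (hp : 2 < p) (hξ : 0 < ξ) (ht : 0 ≤ t) :
    ∫ s in (0:ℝ)..t, ξ ^ 2 / (4 * π * s ^ 3) * Real.exp (-ξ ^ 2 / (2 * s))
      ≤ p ^ p * 2 ^ p / (4 * π) * (∫ s in (0:ℝ)..t, s ^ (p - 3)) * ξ ^ (2 - 2 * p) := by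
  have hpi := Real.pi_pos
  have hint : IntervalIntegrable
      (fun s : ℝ => p ^ p * 2 ^ p / (4 * π) * ξ ^ (2 - 2 * p) * s ^ (p - 3)) volume 0 t :=
    (intervalIntegral.intervalIntegrable_rpow' (by linarith)).const_mul _
  have h := intervalIntegral.norm_integral_le_of_norm_le ht
    (f := fun s : ℝ => ξ ^ 2 / (4 * π * s ^ 3) * Real.exp (-ξ ^ 2 / (2 * s)))
    (Filter.Eventually.of_forall fun s hs => by
      have hs0 : 0 < s := hs.1
      rw [Real.norm_of_nonneg (by positivity)]
      exact covariance_density_le (by linarith) hξ hs0) hint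
  rw [intervalIntegral.integral_const_mul] at h
  calc _ ≤ _ := Real.le_norm_self _
    _ ≤ _ := h
    _ = _ := by ring

/-- A truncated power `min 1 (ξ ^ b)` makes `ξ ^ c` integrable on the half-line when the
exponents are admissible at zero and at infinity. -/
lemma integrableOn_min_one_rpow_mul_rpow {b c : ℝ} (hb : 0 ≤ b) (hbc : -1 < b + c)
    (hc : c < -1) :
    IntegrableOn (fun ξ : ℝ => min 1 (ξ ^ b) * ξ ^ c) (Ioi 0) := by
  rw [← Ioc_union_Ioi_eq_Ioi zero_le_one]
  refine IntegrableOn.union ?_ ?_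
  · have h : IntegrableOn (fun ξ : ℝ => ξ ^ (b + c)) (Ioc 0 1) :=
      (intervalIntegrable_iff_integrableOn_Ioc_of_le zero_le_one).1
        (intervalIntegral.intervalIntegrable_rpow' hbc)
    refine h.congr_fun (fun ξ hξ => ?_) measurableSet_Ioc
    simp only
    rw [min_eq_right (Real.rpow_le_one hξ.1.le hξ.2 hb), Real.rpow_add hξ.1]
  · refine (integrableOn_Ioi_rpow_of_lt hc one_pos).congr_fun (fun ξ hξ => ?_) measurableSet_Ioi
    simp only
    rw [min_eq_left (Real.one_le_rpow (le_of_lt hξ) hb), one_mul]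

/-- estimate (6.3) in Proposition 6.1: with the boundary normal derivative
`(∂G/∂η)(s,ξ,0) = (4πs)^{-1/2}(ξ/s)e^{-ξ²/(4s)}` of the Dirichlet heat kernel, the
weighted double integral `∫₀^∞ ρ(ξ) ∫₀ᵗ ((∂G/∂η)(s,ξ,0))² ds dξ` equals
`∫₀^∞ min(1,ξ^{1+α}) ∫₀ᵗ (ξ²/(4πs³)) e^{-ξ²/(2s)} ds dξ` and is finite. -/
theorem boundary_noise_covariance_integrable
    (α : ℝ) (hα : α ∈ Ioo (0:ℝ) 1) (t : ℝ) (ht : 0 < t) :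
    (∫ ξ in Ioi (0:ℝ), min 1 (ξ ^ (1 + α)) *
        ∫ s in (0:ℝ)..t,
          ((1 / Real.sqrt (4 * π * s)) * (ξ / s) * Real.exp (-ξ ^ 2 / (4 * s))) ^ 2)
      = (∫ ξ in Ioi (0:ℝ), min 1 (ξ ^ (1 + α)) *
          ∫ s in (0:ℝ)..t, ξ ^ 2 / (4 * π * s ^ 3) * Real.exp (-ξ ^ 2 / (2 * s))) ∧
    (∫⁻ ξ in Ioi (0:ℝ), ENNReal.ofReal (min 1 (ξ ^ (1 + α)) *
        ∫ s in (0:ℝ)..t, ξ ^ 2 / (4 * π * s ^ 3) * Real.exp (-ξ ^ 2 / (2 * s))))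
      < ⊤ := by
  refine ⟨?_, ?_⟩
  · congr 1
    ext ξ
    congr 1
    refine intervalIntegral.integral_congr_ae (Filter.Eventually.of_forall fun s hs => ?_)
    rw [uIoc_of_le ht.le] at hs
    exact sq_dirichlet_kernel_normal_deriv ξ hs.1
  · obtain ⟨hα₀, -⟩ := hα
    obtain ⟨p, rfl⟩ : ∃ p, α = 4 * (p - 2) := ⟨2 + α / 4, by ring⟩
    have hint := (integrableOn_min_one_rpow_mul_rpow (b := 1 + 4 * (p - 2)) (c := 2 - 2 * p)
      (by linarith) (by linarith) (by linarith)).const_mul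
        (p ^ p * 2 ^ p / (4 * π) * ∫ s in (0:ℝ)..t, s ^ (p - 3))
    refine lt_of_le_of_lt (setLIntegral_mono' measurableSet_Ioi fun ξ hξ => ?_)
      hint.lintegral_lt_top
    have hξ₀ : 0 < ξ := hξ
    refine ENNReal.ofReal_le_ofReal ?_
    calc _ ≤ min 1 (ξ ^ (1 + 4 * (p - 2))) * _ :=
          mul_le_mul_of_nonneg_left
            (integral_covariance_density_le (p := p) (by linarith) hξ₀ ht.le) (by positivity)
      _ = _ := by ring
end
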